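/- Let (X,d) be a proper length metric space, K : X → [0,∞) continuous with Σ := {K = 0} finite and nonempty, and suppose K(x) ≥ k(d(x,Σ)) for some continuous k : [0,∞) → [0,∞) with ∫_0^∞ k(t) dt = +∞. Then every closed ball of (X, d_K) is d-bounded: for all x₀ ∈ X and R > 0, the set { x ∈ X : d_K(x₀, x) ≤ R } is bounded with respect to d. -/

import Mathlib

open Filter Topology MeasureTheory Set
open scoped ENNReal NNReal Classical

section Defs

variable {X : Type*} [MetricSpace X]

/-- The metric derivative of the curve `γ` within the set `I` at the point `t` exists and has
value `L`, i.e. `lim_{s → t, s ∈ I} dist (γ s) (γ t) / |s - t| = L`. -/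
def HasMetricDerivWithinAt (γ : ℝ → X) (I : Set ℝ) (t : ℝ) (L : ℝ) : Prop :=
  Tendsto (fun s => dist (γ s) (γ t) / |s - t|) (𝓝[I \ {t}] t) (𝓝 L)

/-- The metric derivative `|γ̇|(t)` of `γ` within `I` at `t` (junk value `0` if the defining
limit does not exist). -/
noncomputable def metricDerivWithin (γ : ℝ → X) (I : Set ℝ) (t : ℝ) : ℝ :=
  if h : ∃ L, HasMetricDerivWithinAt γ I t L then h.choose else 0

/-- `γ` is locally Lipschitz on the set `s ⊆ ℝ`. -/
def LocallyLipschitzOnSet (γ : ℝ → X) (s : Set ℝ) : Prop :=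
  ∀ t ∈ s, ∃ ε > 0, ∃ C : NNReal, LipschitzOnWith C γ (s ∩ Metric.ball t ε)

/-- `γ` is a piecewise locally Lipschitz curve on the interval `I`: it is continuous on `I`
and locally Lipschitz outside finitely many points of `I` (equivalently, there are
`t_0 = inf I < t_1 < ⋯ < t_n = sup I` such that `γ` is locally Lipschitz on each
`I ∩ (t_i, t_(i+1))`). -/
def PiecewiseLocLipOn (γ : ℝ → X) (I : Set ℝ) : Prop :=
  ContinuousOn γ I ∧ ∃ S : Finset ℝ, LocallyLipschitzOnSet γ (I \ ↑S)

/-- The `K`-weighted length `L_K(γ) = ∫_I K (γ t) * |γ̇| t dt` of a curve `γ` defined on `I`. -/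
noncomputable def KLength (K : X → ℝ) (γ : ℝ → X) (I : Set ℝ) : ℝ≥0∞ :=
  ∫⁻ t in I, ENNReal.ofReal (K (γ t) * metricDerivWithin γ I t)

/-- The filter of approach to the left endpoint of the interval `I` (the endpoint may be
`-∞`, i.e. `I` may be unbounded below). -/
noncomputable def leftEndFilter (I : Set ℝ) : Filter ℝ :=
  if BddBelow I then 𝓝[I] (sInf I) else Filter.atBot ⊓ Filter.principal I

/-- The filter of approach to the right endpoint of the interval `I`. -/
noncomputable def rightEndFilter (I : Set ℝ) : Filter ℝ :=
  if BddAbove I then 𝓝[I] (sSup I) else Filter.atTop ⊓ Filter.principal I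

/-- `γ`, defined on the nonempty interval `I`, is a path from `x` to `y`: it is continuous on
`I` and converges to `x` (resp. `y`) at the left (resp. right) endpoint of `I` (where the
value at an infinite endpoint is understood as a limit). -/
def IsPathOn (γ : ℝ → X) (I : Set ℝ) (x y : X) : Prop :=
  I.Nonempty ∧ I.OrdConnected ∧ ContinuousOn γ I ∧
    Tendsto γ (leftEndFilter I) (𝓝 x) ∧ Tendsto γ (rightEndFilter I) (𝓝 y)

/-- The weighted (pseudo-)distance `d_K(x,y)`: the infimum of `L_K` over piecewise locally
Lipschitz paths from `x` to `y`. -/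
noncomputable def dK (K : X → ℝ) (x y : X) : ℝ≥0∞ :=
  ⨅ (γ : ℝ → X) (I : Set ℝ) (_ : PiecewiseLocLipOn γ I) (_ : IsPathOn γ I x y),
    KLength K γ I

/-- The intrinsic (geodesic) distance: the infimum of the length `L_d(γ) = eVariationOn γ I`
over all paths from `x` to `y`. -/
noncomputable def geodDist (x y : X) : ℝ≥0∞ :=
  ⨅ (γ : ℝ → X) (I : Set ℝ) (_ : IsPathOn γ I x y), eVariationOn γ I

/-- A length space: the distance coincides with the intrinsic distance. -/
def IsLengthSpace (Y : Type*) [MetricSpace Y] : Prop :=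
  ∀ x y : Y, geodDist x y = edist x y

/-- `K_r(x) := inf { K z : dist x z ≤ r }`. -/
noncomputable def Kinf (K : X → ℝ) (x : X) (r : ℝ) : ℝ :=
  sInf (K '' Metric.closedBall x r)

/-- `K^r(x) := sup { K z : dist x z ≤ r }`. -/
noncomputable def Ksup (K : X → ℝ) (x : X) (r : ℝ) : ℝ :=
  sSup (K '' Metric.closedBall x r)

/-- The energy `E_W(γ) = ∫_I (½ |γ̇|(t)² + W (γ t)) dt`. -/
noncomputable def energyW (W : X → ℝ) (γ : ℝ → X) (I : Set ℝ) : ℝ≥0∞ :=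
  ∫⁻ t in I, ENNReal.ofReal ((metricDerivWithin γ I t) ^ 2 / 2 + W (γ t))

end Defs

section MetricDerivative

variable {X : Type*} [MetricSpace X]

lemma HasMetricDerivWithinAt.metricDerivWithin_eq {γ : ℝ → X} {I : Set ℝ} {t L : ℝ}
    [(𝓝[I \ {t}] t).NeBot] (h : HasMetricDerivWithinAt γ I t L) :
    metricDerivWithin γ I t = L := by
  have hex : ∃ L, HasMetricDerivWithinAt γ I t L := ⟨L, h⟩
  rw [metricDerivWithin, dif_pos hex]
  exact tendsto_nhds_unique hex.choose_spec h

/-- A Lipschitz curve in a separable metric space has a metric derivative almost everywhere. -/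
lemma LipschitzWith.ae_exists_metricDeriv [TopologicalSpace.SeparableSpace X]
    {C : ℝ≥0} {γ : ℝ → X} (hγ : LipschitzWith C γ) :
    ∀ᵐ t, ∃ L, Tendsto (fun s => dist (γ s) (γ t) / |s - t|) (𝓝[≠] t) (𝓝 L) := by
  have : Nonempty X := ⟨γ 0⟩
  set x := TopologicalSpace.denseSeq X
  set φ : ℕ → ℝ → ℝ := fun n t => dist (γ t) (x n)
  have hφ : ∀ n, LipschitzWith C (φ n) := fun n => by
    have := (LipschitzWith.dist_left (x n)).comp hγ
    rwa [one_mul] at this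
  have hderiv : ∀ n t, |deriv (φ n) t| ≤ C := fun n t =>
    norm_deriv_le_of_lipschitz (hφ n)
  set m : ℝ → ℝ := fun t => ⨆ n, |deriv (φ n) t|
  have hbdd : ∀ t, BddAbove (range fun n => |deriv (φ n) t|) := fun t =>
    ⟨C, by rintro _ ⟨n, rfl⟩; exact hderiv n t⟩
  have hle_m : ∀ n t, |deriv (φ n) t| ≤ m t := fun n t => le_ciSup (hbdd t) n
  have hm_le : ∀ t, m t ≤ C := fun t => ciSup_le fun n => hderiv n t
  have hm_nonneg : ∀ t, 0 ≤ m t := fun t => (abs_nonneg _).trans (hle_m 0 t)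
  have hm_meas : Measurable m :=
    Measurable.iSup fun n => (measurable_deriv (φ n)).abs
  have hm_loc : LocallyIntegrable m volume :=
    (locallyIntegrable_const (C : ℝ)).mono hm_meas.aestronglyMeasurable
      (ae_of_all _ fun t => by
        rw [Real.norm_of_nonneg (hm_nonneg t)]
        exact (hm_le t).trans (le_abs_self _))
  have hm_int : ∀ a b, IntervalIntegrable m volume a b := fun a b =>
    intervalIntegrable_iff.mpr
      ((hm_loc.integrableOn_isCompact isCompact_uIcc).mono_set uIoc_subset_uIcc)
  have hφ_le : ∀ n s t, |φ n s - φ n t| ≤ |∫ u in t..s, m u| := by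
    intro n s t
    rw [← ((hφ n).lipschitzOnWith.absolutelyContinuousOnInterval
      (a := t) (b := s)).integral_deriv_eq_sub]
    exact intervalIntegral.norm_integral_le_abs_of_norm_le (f := deriv (φ n))
      (ae_of_all _ fun u => hle_m n u) (hm_int t s)
  have hdist_le : ∀ s t, dist (γ s) (γ t) ≤ |∫ u in t..s, m u| := by
    intro s t
    have hclosed : IsClosed {y : X | dist (γ s) y - dist (γ t) y ≤ |∫ u in t..s, m u|} :=
      isClosed_le (by fun_prop) continuous_const
    have hmem := hclosed.closure_subset_iff.mpr
      (range_subset_iff.mpr fun n => (le_abs_self _).trans (hφ_le n s t))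
      ((TopologicalSpace.denseRange_denseSeq X) (γ t))
    simpa using hmem
  filter_upwards [LocallyIntegrable.ae_hasDerivAt_integral hm_loc,
    ae_all_iff.mpr fun n => (hφ n).ae_differentiableAt_real] with t hMt hφt
  refine ⟨m t, tendsto_order.mpr ⟨fun c hc => ?_, fun c hc => ?_⟩⟩
  · obtain ⟨n, hn⟩ := exists_lt_of_lt_ciSup hc
    have hslope := (hasDerivAt_iff_tendsto_slope.mp (hφt n).hasDerivAt).abs
    filter_upwards [hslope.eventually (lt_mem_nhds hn)] with s hs
    refine hs.trans_le ?_
    rw [slope_def_field, abs_div]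
    gcongr
    exact abs_dist_sub_le _ _ _
  · have hslope := (hasDerivAt_iff_tendsto_slope.mp (hMt t)).abs
    rw [abs_of_nonneg (hm_nonneg t)] at hslope
    filter_upwards [hslope.eventually (gt_mem_nhds hc)] with s hs
    refine lt_of_le_of_lt ?_ hs
    rw [slope_def_field, abs_div, intervalIntegral.integral_same, sub_zero]
    gcongr
    exact hdist_le s t

/-- If the local Lipschitz constant of `H` at `γ t` is at most `c`, then the derivative of `H ∘ γ`
is at most `c` times the metric derivative of `γ`. -/
lemma abs_deriv_comp_le_mul_metricDeriv {γ : ℝ → X} {H : X → ℝ} {t c L : ℝ}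
    (hγ : ContinuousAt γ t)
    (hL : Tendsto (fun s => dist (γ s) (γ t) / |s - t|) (𝓝[≠] t) (𝓝 L))
    (hH : ∀ ε > 0, ∀ᶠ y in 𝓝 (γ t), |H y - H (γ t)| ≤ (c + ε) * dist y (γ t))
    (hd : DifferentiableAt ℝ (H ∘ γ) t) :
    |deriv (H ∘ γ) t| ≤ c * L := by
  have hslope := (hasDerivAt_iff_tendsto_slope.mp hd.hasDerivAt).abs
  have hε : ∀ ε > 0, |deriv (H ∘ γ) t| ≤ (c + ε) * L := by
    intro ε hε
    refine le_of_tendsto_of_tendsto hslope (hL.const_mul (c + ε)) ?_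
    filter_upwards [nhdsWithin_le_nhds (hγ.eventually (hH ε hε))] with s hs
    rw [slope_def_field, abs_div, ← mul_div_assoc]
    gcongr
    exact hs
  have hlim : Tendsto (fun ε => (c + ε) * L) (𝓝[>] 0) (𝓝 ((c + 0) * L)) :=
    ((continuous_const.add continuous_id).mul continuous_const).continuousWithinAt
  rw [add_zero] at hlim
  exact ge_of_tendsto hlim (eventually_mem_nhdsWithin.mono hε)

lemma LipschitzOnWith.edist_comp_le_lintegral_metricDerivWithin
    [TopologicalSpace.SeparableSpace X] {γ : ℝ → X} {I : Set ℝ} {K H : X → ℝ} {a b : ℝ} {C : ℝ≥0}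
    (hab : a ≤ b) (hI : Icc a b ⊆ I) (hγ : LipschitzOnWith C γ (Icc a b))
    (hHl : LocallyLipschitz H)
    (hH : ∀ x, ∀ ε > 0, ∀ᶠ y in 𝓝 x, |H y - H x| ≤ (K x + ε) * dist y x) :
    edist (H (γ a)) (H (γ b)) ≤
      ∫⁻ t in Ioc a b, ENNReal.ofReal (K (γ t) * metricDerivWithin γ I t) := by
  set γ' : ℝ → X := IccExtend hab ((Icc a b).domRestrict γ)
  have hγ' : LipschitzWith C γ' := by
    have := hγ.to_restrict.comp (LipschitzWith.projIcc hab)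
    rwa [mul_one] at this
  have heq : ∀ t ∈ Icc a b, γ' t = γ t := fun t ht => IccExtend_of_mem hab _ ht
  obtain ⟨D, hD⟩ := LocallyLipschitzOn.exists_lipschitzOnWith_of_compact
    (isCompact_Icc (a := a) (b := b)) (hHl.comp hγ'.locallyLipschitz).locallyLipschitzOn
  have hac : AbsolutelyContinuousOnInterval (H ∘ γ') a b :=
    LipschitzOnWith.absolutelyContinuousOnInterval (K := D) (by rwa [uIcc_of_le hab])
  have hbound : ∀ᵐ t ∂volume.restrict (Ioc a b), ‖deriv (H ∘ γ') t‖ₑ ≤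
      ENNReal.ofReal (K (γ t) * metricDerivWithin γ I t) := by
    rw [← restrict_Ioo_eq_restrict_Ioc, ae_restrict_iff' measurableSet_Ioo]
    filter_upwards [hγ'.ae_exists_metricDeriv, hac.ae_differentiableAt] with t hLt hdt ht
    obtain ⟨L, hL⟩ := hLt
    have htI : t ∈ Icc a b := Ioo_subset_Icc_self ht
    have hnhds : Icc a b ∈ 𝓝 t := Icc_mem_nhds ht.1 ht.2
    have hfilter : 𝓝[I \ {t}] t = 𝓝[≠] t := by
      rw [sdiff_eq]
      exact nhdsWithin_inter_of_mem (nhdsWithin_le_nhds (mem_of_superset hnhds hI))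
    have hmd : HasMetricDerivWithinAt γ I t L := by
      rw [HasMetricDerivWithinAt, hfilter]
      refine hL.congr' ?_
      filter_upwards [nhdsWithin_le_nhds hnhds] with s hs
      rw [heq s hs, heq t htI]
    have : (𝓝[I \ {t}] t).NeBot := by rw [hfilter]; infer_instance
    rw [hmd.metricDerivWithin_eq, Real.enorm_eq_ofReal_abs, ← heq t htI]
    exact ENNReal.ofReal_le_ofReal (abs_deriv_comp_le_mul_metricDeriv
      hγ'.continuous.continuousAt hL (hH (γ' t)) (hdt (by rwa [uIcc_of_le hab])))
  calc edist (H (γ a)) (H (γ b)) = ‖∫ t in a..b, deriv (H ∘ γ') t‖ₑ := by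
        rw [hac.integral_deriv_eq_sub, ← edist_eq_enorm_sub, edist_comm, Function.comp_apply,
          Function.comp_apply, heq a (left_mem_Icc.mpr hab), heq b (right_mem_Icc.mpr hab)]
    _ ≤ ∫⁻ t in Ioc a b, ‖deriv (H ∘ γ') t‖ₑ := by
        rw [intervalIntegral.integral_of_le hab]
        exact enorm_integral_le_lintegral_enorm _
    _ ≤ _ := lintegral_mono_ae hbound

end MetricDerivative

/-- An inequality `edist (g a) (g b) ≤ ∫⁻ t in Ioc a b, w t` for a continuous function `g` may be
checked on the compact intervals avoiding a given finite set. -/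
lemma edist_le_lintegral_of_finite_exceptions {E : Type*} [PseudoEMetricSpace E] {I : Set ℝ}
    (hI : I.OrdConnected) {g : ℝ → E} (hg : ContinuousOn g I) {w : ℝ → ℝ≥0∞} (S : Finset ℝ)
    (h : ∀ a b, a ≤ b → Icc a b ⊆ I \ S → edist (g a) (g b) ≤ ∫⁻ t in Ioc a b, w t)
    {a b : ℝ} (hab : a ≤ b) (ha : a ∈ I) (hb : b ∈ I) :
    edist (g a) (g b) ≤ ∫⁻ t in Ioc a b, w t := by
  induction S using Finset.induction_on generalizing a b with
  | empty => exact h a b hab (by simpa using hI.out ha hb)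
  | insert c S _ ih =>
    refine ih (fun a b hab hsub => ?_) hab ha hb
    have hIcc : Icc a b ⊆ I := hsub.trans sdiff_subset
    have avoid : ∀ a' b', a' ≤ b' → Icc a' b' ⊆ Icc a b → c ∉ Icc a' b' →
        edist (g a') (g b') ≤ ∫⁻ t in Ioc a' b', w t := by
      intro a' b' hab' hsub' hc
      refine h a' b' hab' fun t ht => ⟨hIcc (hsub' ht), ?_⟩
      rw [Finset.coe_insert, mem_insert_iff, not_or]
      exact ⟨fun htc => hc (htc ▸ ht), (hsub (hsub' ht)).2⟩
    by_cases hc : c ∈ Icc a b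
    swap
    · exact avoid a b hab subset_rfl hc
    have hleft : edist (g a) (g c) ≤ ∫⁻ t in Ioc a c, w t := by
      rcases hc.1.eq_or_lt with rfl | hac
      · simp
      have hcont : Tendsto g (𝓝[Ico a c] c) (𝓝 (g c)) :=
        (hg c (hIcc hc)).mono (Ico_subset_Icc_self.trans ((Icc_subset_Icc_right hc.2).trans hIcc))
      have : (𝓝[Ico a c] c).NeBot := by
        rw [nhdsWithin_Ico_eq_nhdsLT hac]; infer_instance
      refine le_of_tendsto (tendsto_const_nhds.edist hcont) ?_
      filter_upwards [self_mem_nhdsWithin] with s hs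
      refine (avoid a s hs.1 (Icc_subset_Icc_right (hs.2.le.trans hc.2))
        fun h => h.2.not_gt hs.2).trans ?_
      exact lintegral_mono_set (Ioc_subset_Ioc_right hs.2.le)
    have hright : edist (g c) (g b) ≤ ∫⁻ t in Ioc c b, w t := by
      rcases hc.2.eq_or_lt with rfl | hcb
      · simp
      have hcont : Tendsto g (𝓝[Ioc c b] c) (𝓝 (g c)) :=
        (hg c (hIcc hc)).mono (Ioc_subset_Icc_self.trans ((Icc_subset_Icc_left hc.1).trans hIcc))
      have : (𝓝[Ioc c b] c).NeBot := by
        rw [nhdsWithin_Ioc_eq_nhdsGT hcb]; infer_instance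
      refine le_of_tendsto (hcont.edist tendsto_const_nhds) ?_
      filter_upwards [self_mem_nhdsWithin] with s hs
      refine (avoid s b hs.2 (Icc_subset_Icc_left (hc.1.trans hs.1.le))
        fun h => h.1.not_gt hs.1).trans ?_
      exact lintegral_mono_set (Ioc_subset_Ioc_left hs.1.le)
    calc edist (g a) (g b) ≤ edist (g a) (g c) + edist (g c) (g b) := edist_triangle _ _ _
      _ ≤ (∫⁻ t in Ioc a c, w t) + ∫⁻ t in Ioc c b, w t := add_le_add hleft hright
      _ = ∫⁻ t in Ioc a b, w t := by
        rw [← lintegral_union measurableSet_Ioc (Ioc_disjoint_Ioc_of_le le_rfl),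
          Ioc_union_Ioc_eq_Ioc hc.1 hc.2]

section WeightedDistance

variable {X : Type*} [MetricSpace X]

lemma LocallyLipschitzOnSet.locallyLipschitzOn {γ : ℝ → X} {s : Set ℝ}
    (h : LocallyLipschitzOnSet γ s) : LocallyLipschitzOn s γ := by
  intro t ht
  obtain ⟨ε, hε, C, hC⟩ := h t ht
  exact ⟨C, s ∩ Metric.ball t ε,
    inter_mem self_mem_nhdsWithin (nhdsWithin_le_nhds (Metric.ball_mem_nhds t hε)), hC⟩

lemma leftEndFilter_neBot {I : Set ℝ} (hI : I.Nonempty) : (leftEndFilter I).NeBot := by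
  unfold leftEndFilter
  split_ifs with h
  · exact mem_closure_iff_nhdsWithin_neBot.mp (csInf_mem_closure hI h)
  · rw [← frequently_mem_iff_neBot, frequently_atBot]
    exact fun a => (not_bddBelow_iff.mp h a).imp fun _ hb => ⟨hb.2.le, hb.1⟩

lemma rightEndFilter_neBot {I : Set ℝ} (hI : I.Nonempty) : (rightEndFilter I).NeBot := by
  unfold rightEndFilter
  split_ifs with h
  · exact mem_closure_iff_nhdsWithin_neBot.mp (csSup_mem_closure hI h)
  · rw [← frequently_mem_iff_neBot, frequently_atTop]
    exact fun a => (not_bddAbove_iff.mp h a).imp fun _ hb => ⟨hb.2.le, hb.1⟩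

lemma eventually_mem_leftEndFilter (I : Set ℝ) : ∀ᶠ t in leftEndFilter I, t ∈ I := by
  unfold leftEndFilter
  split_ifs
  · exact self_mem_nhdsWithin
  · exact mem_inf_of_right (mem_principal_self I)

lemma eventually_mem_rightEndFilter (I : Set ℝ) : ∀ᶠ t in rightEndFilter I, t ∈ I := by
  unfold rightEndFilter
  split_ifs
  · exact self_mem_nhdsWithin
  · exact mem_inf_of_right (mem_principal_self I)

/-- A locally Lipschitz function whose local Lipschitz constant is at most `K` is `1`-Lipschitz
for `dK K`. -/
lemma edist_le_dK [TopologicalSpace.SeparableSpace X] {K H : X → ℝ} (hHl : LocallyLipschitz H)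
    (hH : ∀ x, ∀ ε > 0, ∀ᶠ y in 𝓝 x, |H y - H x| ≤ (K x + ε) * dist y x) (x y : X) :
    edist (H x) (H y) ≤ dK K x y := by
  refine le_iInf fun γ => le_iInf fun I => le_iInf fun hγ => le_iInf fun hpath => ?_
  obtain ⟨hcont, S, hS⟩ := hγ
  obtain ⟨hne, hord, -, hx, hy⟩ := hpath
  have hle : ∀ s ∈ I, ∀ t ∈ I, s ≤ t → edist (H (γ s)) (H (γ t)) ≤ KLength K γ I := by
    intro s hs t ht hst
    refine (edist_le_lintegral_of_finite_exceptions hord (hHl.continuous.comp_continuousOn hcont)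
      (w := fun t => ENNReal.ofReal (K (γ t) * metricDerivWithin γ I t)) S
      (fun a b hab hsub => ?_) hst hs ht).trans
      (lintegral_mono_set (Ioc_subset_Icc_self.trans (hord.out hs ht)))
    obtain ⟨C, hC⟩ := (hS.locallyLipschitzOn.mono hsub).exists_lipschitzOnWith_of_compact
      isCompact_Icc
    exact hC.edist_comp_le_lintegral_metricDerivWithin hab (hsub.trans sdiff_subset) hHl hH
  have := leftEndFilter_neBot hne
  have := rightEndFilter_neBot hne
  have hlim : Tendsto (fun p : ℝ × ℝ => edist (H (γ p.1)) (H (γ p.2)))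
      (leftEndFilter I ×ˢ rightEndFilter I) (𝓝 (edist (H x) (H y))) :=
    (((hHl.continuous.tendsto x).comp hx).comp tendsto_fst).edist
      (((hHl.continuous.tendsto y).comp hy).comp tendsto_snd)
  refine le_of_tendsto hlim ?_
  filter_upwards [(eventually_mem_leftEndFilter I).prod_mk (eventually_mem_rightEndFilter I)]
    with p hp
  rcases le_total p.1 p.2 with h | h
  · exact hle _ hp.1 _ hp.2 h
  · rw [edist_comm]
    exact hle _ hp.2 _ hp.1 h

end WeightedDistance

/-- Under hypotheses (H1)-(H3) with `Σ = {K = 0}` nonempty, every closed ball of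
`(X, d_K)` is bounded for the original metric `d`. -/
theorem dK_balls_bounded
    {X : Type*} [MetricSpace X] [ProperSpace X] (hlen : IsLengthSpace X)
    (K : X → ℝ) (hKc : Continuous K) (hK0 : ∀ x, 0 ≤ K x)
    (hfin : {x : X | K x = 0}.Finite) (hne : {x : X | K x = 0}.Nonempty)
    (k : ℝ → ℝ) (hkc : ContinuousOn k (Set.Ici 0)) (hk0 : ∀ t ∈ Set.Ici (0 : ℝ), 0 ≤ k t)
    (hkdiv : ∫⁻ t in Set.Ioi (0 : ℝ), ENNReal.ofReal (k t) = ⊤)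
    (hlow : ∀ x : X, k (Metric.infDist x {x : X | K x = 0}) ≤ K x) :
    ∀ (x₀ : X) (R : ℝ), 0 < R →
      Bornology.IsBounded {x : X | dK K x₀ x ≤ ENNReal.ofReal R} := by
  intro x₀ R hR
  set Z : Set X := {x : X | K x = 0}
  set κ : ℝ → ℝ := fun t => k (max t 0)
  have hκ : Continuous κ :=
    hkc.comp_continuous (by fun_prop) fun t => le_max_right t 0
  have hκ0 : ∀ t, 0 ≤ κ t := fun t => hk0 _ (le_max_right t 0)
  have hκk : ∀ t, 0 ≤ t → κ t = k t := fun t ht => by simp only [κ, max_eq_left ht]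
  set F : ℝ → ℝ := fun r => ∫ t in (0 : ℝ)..r, κ t
  have hF : ∀ r, HasDerivAt F (κ r) r := fun r => hκ.integral_hasStrictDerivAt 0 r |>.hasDerivAt
  have hF1 : ContDiff ℝ 1 F :=
    contDiff_one_iff_deriv.mpr ⟨fun r => (hF r).differentiableAt, by
      rwa [funext fun r => (hF r).deriv]⟩
  set f : X → ℝ := fun x => Metric.infDist x Z
  have hf : LipschitzWith 1 f := Metric.lipschitz_infDist_pt Z
  have hHl : LocallyLipschitz (F ∘ f) := hF1.locallyLipschitz.comp hf.locallyLipschitz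
  have hH : ∀ x, ∀ ε > 0, ∀ᶠ y in 𝓝 x,
      |(F ∘ f) y - (F ∘ f) x| ≤ (K x + ε) * dist y x := by
    intro x ε hε
    have hsmall := (hasDerivAt_iff_isLittleO.mp (hF (f x))).def hε
    filter_upwards [hf.continuous.continuousAt.eventually hsmall] with y hy
    have hfd : |f y - f x| ≤ dist y x := by simpa [Real.dist_eq] using hf.dist_le_mul y x
    have hκK : κ (f x) ≤ K x := (hκk _ Metric.infDist_nonneg).trans_le (hlow x)
    simp only [Real.norm_eq_abs, smul_eq_mul] at hy
    calc |F (f y) - F (f x)|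
        ≤ |F (f y) - F (f x) - (f y - f x) * κ (f x)| + |(f y - f x) * κ (f x)| := by
          simpa using abs_add_le (F (f y) - F (f x) - (f y - f x) * κ (f x))
            ((f y - f x) * κ (f x))
      _ ≤ ε * |f y - f x| + |f y - f x| * κ (f x) := by
          rw [abs_mul, abs_of_nonneg (hκ0 (f x))]
          gcongr
      _ = (κ (f x) + ε) * |f y - f x| := by ring
      _ ≤ (K x + ε) * dist y x := by
          have := hK0 x
          gcongr
  have hFmono : Monotone F :=
    monotone_of_deriv_nonneg (fun r => (hF r).differentiableAt) fun r => by
      rw [(hF r).deriv]; exact hκ0 r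
  obtain ⟨r, hr⟩ : ∃ r, F (f x₀) + R < F r := by
    by_contra! hbd
    refine ENNReal.ofReal_ne_top (r := F (f x₀) + R) (top_le_iff.mp ?_)
    have hκdiv : ∫⁻ t in Ioi (0 : ℝ), ENNReal.ofReal (κ t) = ⊤ := by
      rw [← hkdiv]
      exact setLIntegral_congr_fun measurableSet_Ioi fun t ht => by rw [hκk t (le_of_lt ht)]
    rw [← hκdiv]
    have hlim := (aecover_Iic (μ := volume.restrict (Ioi (0 : ℝ)))
      tendsto_natCast_atTop_atTop).lintegral_tendsto_of_countably_generated
      hκ.measurable.ennreal_ofReal.aemeasurable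
    refine le_of_tendsto' hlim fun n => ?_
    have hFn : ENNReal.ofReal (F n) = ∫⁻ t in Ioc (0 : ℝ) n, ENNReal.ofReal (κ t) := by
      simp only [F]
      rw [intervalIntegral.integral_of_le n.cast_nonneg,
        ofReal_integral_eq_lintegral_ofReal hκ.integrableOn_Ioc (ae_of_all _ hκ0)]
    rw [Measure.restrict_restrict measurableSet_Iic, inter_comm, Ioi_inter_Iic, ← hFn]
    exact ENNReal.ofReal_le_ofReal (hbd n)
  refine (hfin.isBounded.thickening (δ := r)).subset fun x hx => ?_
  have hle : dist ((F ∘ f) x₀) ((F ∘ f) x) ≤ R := by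
    have := (edist_le_dK hHl hH x₀ x).trans hx
    rwa [edist_dist, ENNReal.ofReal_le_ofReal_iff hR.le] at this
  have hFx : F (f x) < F r := by
    have := neg_le_of_abs_le (Real.dist_eq _ _ ▸ hle)
    simp only [Function.comp_apply] at this
    linarith
  have hfx : f x < r := hFmono.reflect_lt hFx
  exact (Metric.mem_thickening_iff_infDist_lt hne).mpr hfx
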